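/- Let n ≥ 2 and let K ∈ ℝ^{n×n} be the composite kernel matrix defined by K_{ij} = α·exp(−‖x_i − x_j‖² / (2σ²)) + (1 − α)·K_class(i,j) with α ∈ [0,1], σ > 0, K_class(i,j) = 1 if y_i = y_j and = γ ∈ (0,1] otherwise. Fix j, set b = K(·,j), and suppose 0 < λ < 2·min_{i ≠ j} K_{ji}·K_{jj}. Then there exists i ≠ j with 2⟨K(·,i), b⟩ > λ, and hence every global minimizer w of F(w) = ‖b − K w‖₂² + λ‖w‖₁ over {w ∈ ℝⁿ : w_j = 0} is nonzero. -/

import Mathlib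

/-- If a column `a` of a matrix satisfies `lam < 2⟨a, b⟩`, then moving a little along `a` strictly
decreases the LASSO objective below its value at `0`. -/
theorem exists_pos_lasso_lt {ι : Type*} [Fintype ι] (a b : ι → ℝ) (lam : ℝ)
    (ha : 0 < ∑ m, a m ^ 2) (h : lam < 2 * ∑ m, a m * b m) :
    ∃ t : ℝ, 0 < t ∧ (∑ m, (b m - a m * t) ^ 2) + lam * t < ∑ m, b m ^ 2 := by
  set S := ∑ m, a m ^ 2
  set c := ∑ m, a m * b m
  have expand (t : ℝ) : ∑ m, (b m - a m * t) ^ 2 = ∑ m, b m ^ 2 - 2 * t * c + t ^ 2 * S := by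
    simp only [S, c, Finset.mul_sum, ← Finset.sum_sub_distrib, ← Finset.sum_add_distrib]
    exact Finset.sum_congr rfl fun m _ => by ring
  have ht : 0 < (2 * c - lam) / (2 * S) := div_pos (by linarith) (by linarith)
  refine ⟨_, ht, ?_⟩
  rw [expand]
  have hS : (2 * c - lam) / (2 * S) * S = (2 * c - lam) / 2 := by field_simp
  nlinarith

/-- **Connectivity Stability for the composite kernel (explicit bound on λ).**
For the composite kernel of Eq. (2), if `0 < λ < 2·min_{i ≠ j} K j i · K j j`,
then some column `i ≠ j` satisfies `2⟨K(·,i), K(·,j)⟩ > λ`, and hence every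
global minimizer of `F(w) = ‖K(·,j) − K w‖₂² + λ‖w‖₁` over `{w : w j = 0}`
is nonzero. -/
theorem stmt9 (n : ℕ) (hn : 2 ≤ n) (d : ℕ) (x : Fin n → EuclideanSpace ℝ (Fin d))
    (Y : Type*) [DecidableEq Y] (y : Fin n → Y)
    (α σ γ : ℝ) (hα0 : 0 ≤ α) (hα1 : α ≤ 1) (hσ : 0 < σ)
    (hγ0 : 0 < γ) (hγ1 : γ ≤ 1)
    (K : Matrix (Fin n) (Fin n) ℝ)
    (hK : ∀ i j, K i j =
      α * Real.exp (-‖x i - x j‖ ^ 2 / (2 * σ ^ 2)) +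
        (1 - α) * (if y i = y j then (1 : ℝ) else γ))
    (j : Fin n) (lam : ℝ) (hlam0 : 0 < lam)
    (hlam : lam < 2 * (Finset.univ.erase j).inf'
      (by
        obtain ⟨i, hi⟩ := Fintype.exists_ne_of_one_lt_card
          (by simpa using (by omega : 1 < n)) j
        exact ⟨i, Finset.mem_erase.2 ⟨hi, Finset.mem_univ i⟩⟩)
      (fun i => K j i * K j j)) :
    (∃ i : Fin n, i ≠ j ∧ lam < 2 * ∑ m, K m i * K m j) ∧
    ∀ w : Fin n → ℝ, w j = 0 →
      (∀ v : Fin n → ℝ, v j = 0 →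
        (∑ m, (K m j - ∑ i, K m i * w i) ^ 2) + lam * ∑ i, |w i| ≤
          (∑ m, (K m j - ∑ i, K m i * v i) ^ 2) + lam * ∑ i, |v i|) →
      w ≠ 0 := by
  have hpos (a b : Fin n) : 0 < K a b := by
    rw [hK]
    have hc : (0 : ℝ) < if y a = y b then (1 : ℝ) else γ := by split_ifs <;> linarith
    rcases hα0.eq_or_lt with rfl | hα
    · simpa using hc
    · exact add_pos_of_pos_of_nonneg (by positivity) (mul_nonneg (by linarith) hc.le)
  obtain ⟨i, hij⟩ : ∃ i, i ≠ j :=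
    Fintype.exists_ne_of_one_lt_card (by simpa using (by omega : 1 < n)) j
  have hmin := Finset.inf'_le (fun i => K j i * K j j)
    (Finset.mem_erase.2 ⟨hij, Finset.mem_univ i⟩)
  have hterm : K j i * K j j ≤ ∑ m, K m i * K m j :=
    Finset.single_le_sum (f := fun m => K m i * K m j)
      (fun m _ => (mul_pos (hpos m i) (hpos m j)).le) (Finset.mem_univ j)
  have hcorr : lam < 2 * ∑ m, K m i * K m j := by linarith
  refine ⟨⟨i, hij, hcorr⟩, ?_⟩
  rintro w - hw rfl
  obtain ⟨t, ht, hlt⟩ := exists_pos_lasso_lt (fun m => K m i) (fun m => K m j) lam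
    (Finset.sum_pos (fun m _ => pow_pos (hpos m i) 2) ⟨j, Finset.mem_univ j⟩) hcorr
  have hle := hw (Pi.single i t) (by simp [hij.symm])
  have habs : ∑ k, |(Pi.single i t : Fin n → ℝ) k| = t := by
    rw [Finset.sum_eq_single i] <;> simp +contextual [abs_of_pos ht]
  rw [habs] at hle
  simp [Pi.single_apply] at hle
  linarith
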